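/- arXiv:1907.08921 — 2 statements merged into one kernel-verified Lean document; each statement's English description precedes it below -/
import Mathlib

section
/- (Q-quadratic convergence of the quasi-Newton / Hewer iteration.) Let K₀ ∈ S and define iterates K_{j+1} = ( R + Bᵀ X(K_j) B )^{−1} Bᵀ X(K_j) A. Then every K_j is Schur-stabilizing, X(K_{j+1}) ⪯ X(K_j), and there exist constants c > 0 and c₃ > 0 such that for all j ≥ 1: f(K_j) − f(K_*) ≤ c ( f(K_{j−1}) − f(K_*) )² and ‖K_j − K_*‖_F ≤ c₃ ‖K_{j−1} − K_*‖_F². -/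
open Matrix

/-- `M` is Schur stable: spectral radius `ρ(M) < 1`. -/
def IsSchur {k : ℕ} (M : Matrix (Fin k) (Fin k) ℝ) : Prop :=
  ∀ μ ∈ spectrum ℂ (M.map (Complex.ofReal ·)), ‖μ‖ < 1

/-- The pair `(A, B)` is controllable (Kalman rank condition). -/
def Controllable {n m : ℕ} (A : Matrix (Fin n) (Fin n) ℝ) (B : Matrix (Fin n) (Fin m) ℝ) : Prop :=
  (Matrix.of fun (i : Fin n) (p : Fin n × Fin m) => (A ^ (p.1 : ℕ) * B) i p.2).rank = n

/-- The Frobenius norm of a real matrix. -/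
noncomputable def frobNorm {a b : ℕ} (K : Matrix (Fin a) (Fin b) ℝ) : ℝ :=
  Real.sqrt (∑ i, ∑ j, (K i j) ^ 2)

section Helpers

open Filter Topology
open scoped Matrix.Norms.Frobenius

lemma tendsto_pow_of_spectralRadius_lt_one {𝔸 : Type*} [NormedRing 𝔸] [NormedAlgebra ℂ 𝔸]
    [CompleteSpace 𝔸] {a : 𝔸} (ha : spectralRadius ℂ a < 1) :
    Tendsto (fun k : ℕ => ‖a ^ k‖) atTop (𝓝 0) := by
  obtain ⟨r, har, hr⟩ := exists_between ha
  lift r to NNReal using (hr.trans ENNReal.one_lt_top).ne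
  have hr1 : (r : ℝ) < 1 := by exact_mod_cast hr
  have h := (spectrum.pow_nnnorm_pow_one_div_tendsto_nhds_spectralRadius a).eventually_lt_const har
  refine squeeze_zero' (Eventually.of_forall fun _ => norm_nonneg _) ?_
    (tendsto_pow_atTop_nhds_zero_of_lt_one r.coe_nonneg hr1)
  filter_upwards [h, eventually_gt_atTop 0] with k hk hk0
  have hk' : ((‖a ^ k‖₊ : ENNReal) ^ (1 / k : ℝ)) ^ (k : ℝ) ≤ (r : ENNReal) ^ (k : ℝ) :=
    ENNReal.rpow_le_rpow hk.le (Nat.cast_nonneg _)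
  rw [← ENNReal.rpow_mul, one_div_mul_cancel (by positivity), ENNReal.rpow_one,
    ENNReal.rpow_natCast] at hk'
  exact_mod_cast hk'

lemma IsSchur.tendsto_norm_pow {n : ℕ} {M : Matrix (Fin n) (Fin n) ℝ} (hM : IsSchur M) :
    Tendsto (fun k : ℕ => ‖M ^ k‖) atTop (𝓝 0) := by
  rcases isEmpty_or_nonempty (Fin n) with h | h
  · simp [Subsingleton.elim _ (0 : Matrix (Fin n) (Fin n) ℝ)]
  · have hr : spectralRadius ℂ (M.map (Complex.ofReal ·)) < 1 :=
      spectrum.spectralRadius_lt_of_forall_lt (r := 1) _ fun z hz => hM z hz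
    refine (tendsto_pow_of_spectralRadius_lt_one hr).congr fun k => ?_
    rw [← frobenius_norm_map_eq (M ^ k) Complex.ofReal (fun a => by simp)]
    congr 1
    exact (map_pow (Complex.ofRealHom.mapMatrix (m := Fin n)) M k).symm

lemma Matrix.PosSemidef.transpose_mul_mul_same {a b : Type*} [Fintype a] [Fintype b]
    {P : Matrix a a ℝ} (hP : P.PosSemidef) (N : Matrix a b ℝ) : (Nᵀ * P * N).PosSemidef := by
  simpa using hP.conjTranspose_mul_mul_same N

lemma Matrix.PosSemidef.exists_eq_transpose_mul_self {a : Type*} [Fintype a] {P : Matrix a a ℝ}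
    (hP : P.PosSemidef) : ∃ N : Matrix a a ℝ, P = Nᵀ * N := by
  open scoped MatrixOrder in
  classical
  obtain ⟨N, hN⟩ := CStarAlgebra.nonneg_iff_eq_star_mul_self.mp hP.nonneg
  exact ⟨N, by simpa [star_eq_conjTranspose] using hN⟩

lemma Matrix.posSemidef_of_tendsto {a : Type*} [Fintype a] {P : ℕ → Matrix a a ℝ}
    {L : Matrix a a ℝ} (hP : ∀ k, (P k).PosSemidef) (h : Tendsto P atTop (𝓝 L)) :
    L.PosSemidef := by
  refine PosSemidef.of_dotProduct_mulVec_nonneg ?_ fun x => ?_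
  · have h' : Tendsto (fun k => (P k)ᴴ) atTop (𝓝 Lᴴ) :=
      (continuous_id.matrix_conjTranspose.tendsto L).comp h
    simp only [fun k => (hP k).isHermitian.eq] at h'
    exact tendsto_nhds_unique h' h
  · have hc : Continuous fun M : Matrix a a ℝ => star x ⬝ᵥ (M *ᵥ x) := by fun_prop
    exact ge_of_tendsto' ((hc.tendsto L).comp h) fun k => (hP k).dotProduct_mulVec_nonneg x

/-- A solution of the discrete Lyapunov equation with stable `M` and positive semidefinite
right-hand side is positive semidefinite. -/
lemma IsSchur.posSemidef_of_lyapunov {n : ℕ} {M Y W : Matrix (Fin n) (Fin n) ℝ} (hM : IsSchur M)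
    (hW : W.PosSemidef) (hY : Mᵀ * Y * M + W = Y) : Y.PosSemidef := by
  have hstep (k : ℕ) : (Y - (M ^ k)ᵀ * Y * M ^ k).PosSemidef := by
    induction k with
    | zero => simpa using PosSemidef.zero
    | succ k ih =>
      have : Y - (M ^ (k + 1))ᵀ * Y * M ^ (k + 1) =
          (Y - (M ^ k)ᵀ * Y * M ^ k) + (M ^ k)ᵀ * W * M ^ k := by
        rw [← sub_eq_iff_eq_add'.mpr hY.symm, pow_succ', transpose_mul]
        noncomm_ring
      rw [this]
      exact ih.add (hW.transpose_mul_mul_same _)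
  refine posSemidef_of_tendsto hstep ?_
  have h0 : Tendsto (fun k => (M ^ k)ᵀ * Y * M ^ k) atTop (𝓝 0) := by
    refine squeeze_zero_norm (a := fun k => ‖M ^ k‖ * ‖Y‖ * ‖M ^ k‖) (fun k => ?_) ?_
    · refine (frobenius_norm_mul _ _).trans ?_
      gcongr
      exact (frobenius_norm_mul _ _).trans_eq (by rw [frobenius_norm_transpose])
    · simpa using (hM.tendsto_norm_pow.mul_const ‖Y‖).mul hM.tendsto_norm_pow
  simpa using tendsto_const_nhds.sub h0

lemma isSchur_of_lyapunov {n : ℕ} {M X : Matrix (Fin n) (Fin n) ℝ} (hX : X.PosSemidef)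
    (h : (X - Mᵀ * X * M).PosDef) : IsSchur M := by
  intro μ hμ
  rw [spectrum.mem_iff, isUnit_iff_isUnit_det, isUnit_iff_ne_zero, not_not,
    ← exists_mulVec_eq_zero_iff] at hμ
  obtain ⟨v, hv0, hv⟩ := hμ
  rw [sub_mulVec, sub_eq_zero, Algebra.algebraMap_eq_smul_one, smul_mulVec, one_mulVec] at hv
  set a : Fin n → ℝ := fun i => (v i).re with ha
  set b : Fin n → ℝ := fun i => (v i).im with hb
  have hMa : M *ᵥ a = μ.re • a - μ.im • b := by
    ext i
    simpa [mulVec, dotProduct, ha, hb] using (congrArg Complex.re (congrFun hv i)).symm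
  have hMb : M *ᵥ b = μ.re • b + μ.im • a := by
    ext i
    simpa [mulVec, dotProduct, ha, hb] using (congrArg Complex.im (congrFun hv i)).symm
  have hquad (x : Fin n → ℝ) : x ⬝ᵥ ((X - Mᵀ * X * M) *ᵥ x) =
      x ⬝ᵥ (X *ᵥ x) - (M *ᵥ x) ⬝ᵥ (X *ᵥ (M *ᵥ x)) := by
    rw [sub_mulVec, dotProduct_sub, ← mulVec_mulVec, ← mulVec_mulVec, dotProduct_mulVec x Mᵀ,
      vecMul_transpose]
  have hpos : 0 < a ⬝ᵥ ((X - Mᵀ * X * M) *ᵥ a) + b ⬝ᵥ ((X - Mᵀ * X * M) *ᵥ b) := by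
    have h1 := h.posSemidef.dotProduct_mulVec_nonneg a
    have h2 := h.posSemidef.dotProduct_mulVec_nonneg b
    by_cases ha0 : a = 0
    · have hb0 : b ≠ 0 := fun hb0 => hv0 <| by
        ext i
        exact Complex.ext (congrFun ha0 i) (congrFun hb0 i)
      exact add_pos_of_nonneg_of_pos h1 (h.dotProduct_mulVec_pos hb0)
    · exact add_pos_of_pos_of_nonneg (h.dotProduct_mulVec_pos ha0) h2
  have hXa : 0 ≤ a ⬝ᵥ (X *ᵥ a) := hX.dotProduct_mulVec_nonneg a
  have hXb : 0 ≤ b ⬝ᵥ (X *ᵥ b) := hX.dotProduct_mulVec_nonneg b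
  rw [hquad, hquad, hMa, hMb] at hpos
  simp only [mulVec_sub, mulVec_add, mulVec_smul, dotProduct_sub, dotProduct_add, sub_dotProduct,
    add_dotProduct, smul_dotProduct, dotProduct_smul, smul_eq_mul] at hpos
  have hsq : μ.re ^ 2 + μ.im ^ 2 < 1 := by
    by_contra! hge
    nlinarith [mul_nonneg (sub_nonneg.mpr hge) (add_nonneg hXa hXb)]
  rw [← sq_lt_one_iff₀ (norm_nonneg _), Complex.sq_norm, Complex.normSq_apply]
  linarith

lemma Matrix.frobenius_norm_sq {a b : Type*} [Fintype a] [Fintype b] (N : Matrix a b ℝ) :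
    ‖N‖ ^ 2 = (Nᵀ * N).trace := by
  rw [frobenius_norm_def, ← Real.sqrt_eq_rpow, Real.sq_sqrt (by positivity), Finset.sum_comm]
  simp [trace, mul_apply, ← sq]

lemma Matrix.PosSemidef.norm_le_trace {a : Type*} [Fintype a] {P : Matrix a a ℝ}
    (hP : P.PosSemidef) : ‖P‖ ≤ P.trace := by
  obtain ⟨N, rfl⟩ := hP.exists_eq_transpose_mul_self
  rw [← frobenius_norm_sq, sq]
  exact (frobenius_norm_mul _ _).trans_eq (by rw [frobenius_norm_transpose])

lemma Matrix.PosSemidef.trace_mul_nonneg {a : Type*} [Fintype a] {P S : Matrix a a ℝ}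
    (hP : P.PosSemidef) (hS : S.PosSemidef) : 0 ≤ (P * S).trace := by
  obtain ⟨N, rfl⟩ := hS.exists_eq_transpose_mul_self
  rw [← mul_assoc, trace_mul_comm, ← mul_assoc]
  simpa using (hP.mul_mul_conjTranspose_same N).trace_nonneg

lemma Matrix.frobenius_norm_replicateCol_sq {a : Type*} [Fintype a] (x : a → ℝ) :
    ‖replicateCol Unit x‖ ^ 2 = x ⬝ᵥ x := by
  rw [frobenius_norm_sq]
  simp [trace, mul_apply, dotProduct]

lemma Matrix.dotProduct_mulVec_self_le {a b : Type*} [Fintype a] [Fintype b] (N : Matrix a b ℝ)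
    (x : b → ℝ) : (N *ᵥ x) ⬝ᵥ (N *ᵥ x) ≤ ‖N‖ ^ 2 * (x ⬝ᵥ x) := by
  rw [← frobenius_norm_replicateCol_sq, ← frobenius_norm_replicateCol_sq, replicateCol_mulVec,
    ← mul_pow]
  gcongr
  exact frobenius_norm_mul _ _

lemma Matrix.PosSemidef.trace_smul_one_sub {a : Type*} [Fintype a] [DecidableEq a]
    {W : Matrix a a ℝ} (hW : W.PosSemidef) : (W.trace • 1 - W).PosSemidef := by
  obtain ⟨N, rfl⟩ := hW.exists_eq_transpose_mul_self
  refine .of_dotProduct_mulVec_nonneg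
    ((isHermitian_one.smul (IsSelfAdjoint.all _)).sub hW.isHermitian) fun x => ?_
  rw [sub_mulVec, smul_mulVec, one_mulVec, dotProduct_sub, ← frobenius_norm_sq, ← mulVec_mulVec,
    dotProduct_mulVec _ Nᵀ, vecMul_transpose, sub_nonneg, dotProduct_smul]
  exact dotProduct_mulVec_self_le N x

lemma Matrix.PosDef.exists_sub_smul_one_posSemidef {a : Type*} [Fintype a] [DecidableEq a]
    {Q : Matrix a a ℝ} (hQ : Q.PosDef) : ∃ l > (0 : ℝ), (Q - l • 1).PosSemidef := by
  obtain ⟨P, rfl⟩ := hQ.posSemidef.exists_eq_transpose_mul_self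
  have hP : IsUnit P.det := by
    have := hQ.det_pos.ne'
    rw [det_mul] at this
    exact (right_ne_zero_of_mul this).isUnit
  refine ⟨(‖P⁻¹‖ ^ 2 + 1)⁻¹, by positivity,
    .of_dotProduct_mulVec_nonneg
      (hQ.isHermitian.sub (isHermitian_one.smul (IsSelfAdjoint.all _))) fun x => ?_⟩
  have h := dotProduct_mulVec_self_le P⁻¹ (P *ᵥ x)
  rw [mulVec_mulVec, nonsing_inv_mul _ hP, one_mulVec] at h
  have hPx : 0 ≤ (P *ᵥ x) ⬝ᵥ (P *ᵥ x) := dotProduct_self_star_nonneg _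
  rw [sub_mulVec, smul_mulVec, one_mulVec, dotProduct_sub, ← mulVec_mulVec,
    dotProduct_mulVec _ Pᵀ, vecMul_transpose, sub_nonneg, dotProduct_smul, smul_eq_mul,
    inv_mul_le_iff₀ (by positivity), star_trivial]
  linarith

lemma frobNorm_eq_norm {a b : ℕ} (K : Matrix (Fin a) (Fin b) ℝ) : frobNorm K = ‖K‖ := by
  simp [frobNorm, frobenius_norm_def, Real.sqrt_eq_rpow]

lemma Matrix.trace_transpose_mul_le {a b : Type*} [Fintype a] [Fintype b] (M N : Matrix a b ℝ) :
    (Mᵀ * N).trace ≤ ‖M‖ * ‖N‖ := by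
  have h := Real.sum_mul_le_sqrt_mul_sqrt Finset.univ (fun p : b × a => M p.2 p.1)
    (fun p => N p.2 p.1)
  simp only [Fintype.sum_prod_type] at h
  rw [Finset.sum_comm (f := fun i j => M j i ^ 2), Finset.sum_comm (f := fun i j => N j i ^ 2)] at h
  simpa [trace, mul_apply, frobenius_norm_def, Real.sqrt_eq_rpow] using h

lemma Matrix.smul_norm_sq_le_trace {a b : Type*} [Fintype a] [DecidableEq a] [Fintype b]
    {G : Matrix a a ℝ} {r : ℝ} (hG : (G - r • 1).PosSemidef) (N : Matrix a b ℝ) :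
    r * ‖N‖ ^ 2 ≤ (Nᵀ * G * N).trace := by
  have h := (hG.transpose_mul_mul_same N).trace_nonneg
  rw [Matrix.mul_sub, Matrix.sub_mul, trace_sub, Matrix.mul_smul, Matrix.mul_one, Matrix.smul_mul,
    trace_smul, ← frobenius_norm_sq, smul_eq_mul] at h
  linarith

lemma Matrix.smul_trace_le_trace_mul {a : Type*} [Fintype a] [DecidableEq a]
    {P S : Matrix a a ℝ} {s : ℝ} (hP : P.PosSemidef) (hS : (S - s • 1).PosSemidef) :
    s * P.trace ≤ (P * S).trace := by
  have h := hP.trace_mul_nonneg hS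
  rw [Matrix.mul_sub, trace_sub, Matrix.mul_smul, Matrix.mul_one, trace_smul, smul_eq_mul] at h
  linarith

lemma Matrix.PosSemidef.trace_le_trace {a : Type*} [Fintype a] {P S : Matrix a a ℝ}
    (h : (P - S).PosSemidef) : S.trace ≤ P.trace := by
  simpa using h.trace_nonneg

section LQR

variable {n m : ℕ} {A Q X : Matrix (Fin n) (Fin n) ℝ} {B : Matrix (Fin n) (Fin m) ℝ}
  {R : Matrix (Fin m) (Fin m) ℝ} {K L : Matrix (Fin m) (Fin n) ℝ}

/-- `X` satisfies the Lyapunov equation of the LQR cost of the feedback gain `K`. -/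
def IsLQRValue (A Q : Matrix (Fin n) (Fin n) ℝ) (B : Matrix (Fin n) (Fin m) ℝ)
    (R : Matrix (Fin m) (Fin m) ℝ) (K : Matrix (Fin m) (Fin n) ℝ)
    (X : Matrix (Fin n) (Fin n) ℝ) : Prop :=
  (A - B * K)ᵀ * X * (A - B * K) + Kᵀ * R * K + Q = X

/-- `K` is a greedy (policy improvement) gain for the value matrix `X`. -/
def IsGreedyGain (A : Matrix (Fin n) (Fin n) ℝ) (B : Matrix (Fin n) (Fin m) ℝ)
    (R : Matrix (Fin m) (Fin m) ℝ) (X : Matrix (Fin n) (Fin n) ℝ)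
    (K : Matrix (Fin m) (Fin n) ℝ) : Prop :=
  (R + Bᵀ * X * B) * K = Bᵀ * X * A

lemma isGreedyGain_inv_mul (hR : R.PosDef) (hX : X.PosSemidef) :
    IsGreedyGain A B R X ((R + Bᵀ * X * B)⁻¹ * (Bᵀ * X * A)) := by
  have hG := hR.add_posSemidef (hX.transpose_mul_mul_same B)
  rw [IsGreedyGain, mul_nonsing_inv_cancel_left _ _ hG.det_pos.ne'.isUnit]

lemma IsLQRValue.posSemidef (hX : IsLQRValue A Q B R K X) (hQ : Q.PosDef) (hR : R.PosDef)
    (hK : IsSchur (A - B * K)) : X.PosSemidef :=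
  hK.posSemidef_of_lyapunov ((hR.posSemidef.transpose_mul_mul_same K).add hQ.posSemidef)
    (by rw [← add_assoc]; exact hX)

lemma IsSchur.sub_posSemidef_of_lyapunov {M Y W : Matrix (Fin n) (Fin n) ℝ} (hM : IsSchur M)
    (hW : W.PosSemidef) (hY : Mᵀ * Y * M + W = Y) : (Y - W).PosSemidef := by
  rw [← eq_sub_iff_add_eq.mpr hY]
  exact (hM.posSemidef_of_lyapunov hW hY).transpose_mul_mul_same M

/-- Completion of the square around a greedy gain. -/
lemma IsGreedyGain.completion (hK : IsGreedyGain A B R X K) (hR : Rᵀ = R) (hX : Xᵀ = X)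
    (L : Matrix (Fin m) (Fin n) ℝ) :
    (A - B * L)ᵀ * X * (A - B * L) + Lᵀ * R * L =
      (A - B * K)ᵀ * X * (A - B * K) + Kᵀ * R * K +
        (L - K)ᵀ * (R + Bᵀ * X * B) * (L - K) := by
  have h1 : Bᵀ * (X * A) = R * K + Bᵀ * (X * (B * K)) := by
    rw [← Matrix.mul_assoc, ← hK]
    simp [Matrix.add_mul, Matrix.mul_assoc]
  have h2 (N : Matrix (Fin m) (Fin n) ℝ) :
      Aᵀ * (X * (B * N)) = Kᵀ * (R * N) + Kᵀ * (Bᵀ * (X * (B * N))) := by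
    have := congrArg (fun Z => Zᵀ * N) hK
    simp only [transpose_mul, transpose_add, transpose_transpose, hR, hX] at this
    simpa [Matrix.add_mul, Matrix.mul_add, Matrix.mul_assoc] using this.symm
  simp only [transpose_sub, transpose_mul, Matrix.sub_mul, Matrix.mul_sub, Matrix.add_mul,
    Matrix.mul_add, Matrix.mul_assoc, h1, h2]
  abel

lemma IsLQRValue.isSchur_of_isGreedyGain (hX : IsLQRValue A Q B R K X) (hQ : Q.PosDef)
    (hR : R.PosDef) (hX0 : X.PosSemidef) (hL : IsGreedyGain A B R X L) :
    IsSchur (A - B * L) := by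
  refine isSchur_of_lyapunov hX0 ?_
  have hG := hR.posSemidef.add (hX0.transpose_mul_mul_same B)
  have h := hL.completion hR.isHermitian hX0.isHermitian K
  have : X - (A - B * L)ᵀ * X * (A - B * L) =
      Lᵀ * R * L + (K - L)ᵀ * (R + Bᵀ * X * B) * (K - L) + Q := by
    nth_rw 1 [← hX]
    rw [h]
    abel
  rw [this]
  exact hQ.posSemidef_add
    ((hR.posSemidef.transpose_mul_mul_same L).add (hG.transpose_mul_mul_same _))

/-- Policy improvement. -/
lemma IsLQRValue.sub_lyapunov_of_isGreedyGain {Y : Matrix (Fin n) (Fin n) ℝ}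
    (hX : IsLQRValue A Q B R K X) (hR : R.PosDef) (hX0 : X.PosSemidef)
    (hL : IsGreedyGain A B R X L) (hY : IsLQRValue A Q B R L Y) :
    (A - B * L)ᵀ * (X - Y) * (A - B * L) + (K - L)ᵀ * (R + Bᵀ * X * B) * (K - L) = X - Y := by
  have h := hL.completion hR.isHermitian hX0.isHermitian K
  unfold IsLQRValue at hX hY
  nth_rw 3 [← hX]
  nth_rw 2 [← hY]
  rw [h, Matrix.mul_sub _ X Y, Matrix.sub_mul _ _ (A - B * L)]
  abel

/-- Excess cost over a value matrix whose own gain is greedy. -/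
lemma IsLQRValue.excess_lyapunov {Y : Matrix (Fin n) (Fin n) ℝ}
    (hX : IsLQRValue A Q B R K X) (hR : R.PosDef) (hX0 : X.PosSemidef)
    (hK : IsGreedyGain A B R X K) (hY : IsLQRValue A Q B R L Y) :
    (A - B * L)ᵀ * (Y - X) * (A - B * L) + (L - K)ᵀ * (R + Bᵀ * X * B) * (L - K) = Y - X := by
  have h := hK.completion hR.isHermitian hX0.isHermitian L
  have hX' : X = (A - B * L)ᵀ * X * (A - B * L) + Lᵀ * R * L -
      (L - K)ᵀ * (R + Bᵀ * X * B) * (L - K) + Q := by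
    rw [h, add_sub_cancel_right]
    exact hX.symm
  unfold IsLQRValue at hY
  nth_rw 3 [hX']
  nth_rw 2 [← hY]
  rw [Matrix.mul_sub _ Y X, Matrix.sub_mul _ _ (A - B * L)]
  abel

/-- A Lyapunov solution with stable closed-loop matrix is dominated by the LQR value. -/
lemma IsLQRValue.trace_le_of_lyapunov {W Y : Matrix (Fin n) (Fin n) ℝ} {q : ℝ}
    (hX : IsLQRValue A Q B R K X) (hR : R.PosDef) (hK : IsSchur (A - B * K))
    (hq : 0 < q) (hQ : (Q - q • 1).PosSemidef) (hW : W.PosSemidef)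
    (hY : (A - B * K)ᵀ * Y * (A - B * K) + W = Y) :
    Y.trace ≤ W.trace / q * X.trace := by
  have ht : 0 ≤ W.trace / q := div_nonneg hW.trace_nonneg hq.le
  set t := W.trace / q with ht'
  have hWt : W.trace = t * q := by rw [ht']; field_simp
  have hpos : (t • (Kᵀ * R * K + (Q - q • 1)) + (W.trace • 1 - W)).PosSemidef :=
    (((hR.posSemidef.transpose_mul_mul_same K).add hQ).smul ht).add hW.trace_smul_one_sub
  have h : (t • X - Y).PosSemidef := by
    refine hK.posSemidef_of_lyapunov hpos ?_
    unfold IsLQRValue at hX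
    nth_rw 2 [← hX, ← hY]
    rw [hWt]
    simp only [Matrix.mul_sub, Matrix.sub_mul, Matrix.mul_smul, Matrix.smul_mul, smul_add, smul_sub,
      mul_smul]
    abel
  simpa using h.trace_le_trace

lemma norm_greedyGain_sub_le {Y : Matrix (Fin n) (Fin n) ℝ} {r : ℝ} (hr : 0 < r)
    (hRr : (R - r • 1).PosSemidef) (hY0 : Y.PosSemidef)
    (hK : IsGreedyGain A B R X K) (hL : IsGreedyGain A B R Y L) :
    ‖L - K‖ ≤ ‖B‖ * ‖A - B * K‖ / r * ‖Y - X‖ := by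
  have hG : (R + Bᵀ * Y * B - r • 1).PosSemidef := by
    rw [add_sub_right_comm]
    exact hRr.add (hY0.transpose_mul_mul_same B)
  have hE : (R + Bᵀ * Y * B) * (L - K) = Bᵀ * (Y - X) * (A - B * K) := by
    unfold IsGreedyGain at hK hL
    have hRK : R * K = Bᵀ * X * A - Bᵀ * X * B * K := by rw [← hK]; simp [Matrix.add_mul]
    rw [Matrix.mul_sub, hL, Matrix.add_mul, hRK]
    simp only [Matrix.mul_sub, Matrix.sub_mul, Matrix.mul_assoc]
    abel
  have h1 := smul_norm_sq_le_trace hG (L - K)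
  rw [Matrix.mul_assoc, hE] at h1
  have h2 : ‖Bᵀ * (Y - X) * (A - B * K)‖ ≤ ‖B‖ * ‖Y - X‖ * ‖A - B * K‖ := by
    refine (frobenius_norm_mul _ _).trans ?_
    gcongr
    exact (frobenius_norm_mul _ _).trans_eq (by rw [frobenius_norm_transpose])
  have h3 := h1.trans (trace_transpose_mul_le _ _)
  rcases (norm_nonneg (L - K)).eq_or_lt with h0 | h0
  · rw [← h0]; positivity
  · rw [sq, mul_left_comm] at h3
    have h4 := (le_of_mul_le_mul_left h3 h0).trans h2
    rw [div_mul_eq_mul_div, le_div_iff₀ hr]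
    linarith

/-- An optimal gain is greedy for its own value. -/
lemma IsLQRValue.isGreedyGain_of_trace_le {Sig Y : Matrix (Fin n) (Fin n) ℝ}
    (hX : IsLQRValue A Q B R K X) (hQ : Q.PosDef) (hR : R.PosDef) (hSig : Sig.PosDef)
    (hX0 : X.PosSemidef) (hL : IsGreedyGain A B R X L) (hY : IsLQRValue A Q B R L Y)
    (hXY : (X * Sig).trace ≤ (Y * Sig).trace) : IsGreedyGain A B R X K := by
  obtain ⟨r, hr, hRr⟩ := hR.exists_sub_smul_one_posSemidef
  obtain ⟨s, hs, hSs⟩ := hSig.exists_sub_smul_one_posSemidef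
  have hGr : (R + Bᵀ * X * B - r • 1).PosSemidef := by
    rw [add_sub_right_comm]
    exact hRr.add (hX0.transpose_mul_mul_same B)
  have hW := (hR.posSemidef.add (hX0.transpose_mul_mul_same B)).transpose_mul_mul_same (K - L)
  have h1 := ((hX.isSchur_of_isGreedyGain hQ hR hX0 hL).sub_posSemidef_of_lyapunov hW
    (hX.sub_lyapunov_of_isGreedyGain hR hX0 hL hY)).trace_mul_nonneg hSig.posSemidef
  have h2 := smul_trace_le_trace_mul hW hSs
  have h3 := mul_le_mul_of_nonneg_left (smul_norm_sq_le_trace hGr (K - L)) hs.le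
  rw [Matrix.sub_mul, Matrix.sub_mul, trace_sub, trace_sub] at h1
  have h4 : s * (r * ‖K - L‖ ^ 2) ≤ 0 := by linarith
  have h5 : ‖K - L‖ = 0 := by
    by_contra h
    have : 0 < s * (r * ‖K - L‖ ^ 2) := by positivity
    linarith
  rwa [sub_eq_zero.mp (norm_eq_zero.mp h5)]

end LQR

end Helpers

theorem stmt18 {n m : ℕ} (hn : 0 < n) (hm : 0 < m)
    (A : Matrix (Fin n) (Fin n) ℝ) (B : Matrix (Fin n) (Fin m) ℝ)
    (hAB : Controllable A B)
    (Q Sig : Matrix (Fin n) (Fin n) ℝ) (R : Matrix (Fin m) (Fin m) ℝ)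
    (hQ : Q.PosDef) (hR : R.PosDef) (hSig : Sig.PosDef)
    (X : Matrix (Fin m) (Fin n) ℝ → Matrix (Fin n) (Fin n) ℝ)
    (hX : ∀ K, IsSchur (A - B * K) →
      (A - B * K)ᵀ * X K * (A - B * K) + Kᵀ * R * K + Q = X K)
    -- `Kstar` is the global minimizer of `f` over `S`
    (Kstar : Matrix (Fin m) (Fin n) ℝ) (hKstar : IsSchur (A - B * Kstar))
    (hmin : ∀ K, IsSchur (A - B * K) →
      Matrix.trace (X Kstar * Sig) ≤ Matrix.trace (X K * Sig))
    -- the quasi-Newton (Hewer) iterates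
    (K₀ : Matrix (Fin m) (Fin n) ℝ) (hK₀ : IsSchur (A - B * K₀))
    (Kseq : ℕ → Matrix (Fin m) (Fin n) ℝ) (hK0 : Kseq 0 = K₀)
    (hrec : ∀ j, Kseq (j + 1) = (R + Bᵀ * X (Kseq j) * B)⁻¹ * (Bᵀ * X (Kseq j) * A)) :
    (∀ j, IsSchur (A - B * Kseq j)) ∧
    (∀ j, (X (Kseq j) - X (Kseq (j + 1))).PosSemidef) ∧
    ∃ c > (0 : ℝ), ∃ c₃ > (0 : ℝ), ∀ j : ℕ,
      Matrix.trace (X (Kseq (j + 1)) * Sig) - Matrix.trace (X Kstar * Sig)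
          ≤ c * (Matrix.trace (X (Kseq j) * Sig) - Matrix.trace (X Kstar * Sig)) ^ 2 ∧
      frobNorm (Kseq (j + 1) - Kstar) ≤ c₃ * frobNorm (Kseq j - Kstar) ^ 2 := by
  open scoped Matrix.Norms.Frobenius in
  have hV (K) (hK : IsSchur (A - B * K)) : IsLQRValue A Q B R K (X K) := hX K hK
  have hP (K) (hK : IsSchur (A - B * K)) : (X K).PosSemidef := (hV K hK).posSemidef hQ hR hK
  have hS (j : ℕ) : IsSchur (A - B * Kseq j) := by
    induction j with
    | zero => rwa [hK0]
    | succ j ih =>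
      rw [hrec]
      exact (hV _ ih).isSchur_of_isGreedyGain hQ hR (hP _ ih) (isGreedyGain_inv_mul hR (hP _ ih))
  have hgreedy (j : ℕ) : IsGreedyGain A B R (X (Kseq j)) (Kseq (j + 1)) := by
    rw [hrec]
    exact isGreedyGain_inv_mul hR (hP _ (hS j))
  have hG (j : ℕ) := hR.posSemidef.add ((hP _ (hS j)).transpose_mul_mul_same B)
  have hmono (j : ℕ) : (X (Kseq j) - X (Kseq (j + 1))).PosSemidef :=
    (hS (j + 1)).posSemidef_of_lyapunov ((hG j).transpose_mul_mul_same (Kseq j - Kseq (j + 1)))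
      ((hV _ (hS j)).sub_lyapunov_of_isGreedyGain hR (hP _ (hS j)) (hgreedy j) (hV _ (hS (j + 1))))
  refine ⟨hS, hmono, ?_⟩
  have hPs := hP _ hKstar
  have hLgreedy := isGreedyGain_inv_mul (A := A) (B := B) hR hPs
  have hLS := (hV _ hKstar).isSchur_of_isGreedyGain hQ hR hPs hLgreedy
  have hstar : IsGreedyGain A B R (X Kstar) Kstar :=
    (hV _ hKstar).isGreedyGain_of_trace_le hQ hR hSig hPs hLgreedy (hV _ hLS) (hmin _ hLS)
  obtain ⟨q, hq, hQq⟩ := hQ.exists_sub_smul_one_posSemidef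
  obtain ⟨r, hr, hRr⟩ := hR.exists_sub_smul_one_posSemidef
  obtain ⟨s, hs, hSs⟩ := hSig.exists_sub_smul_one_posSemidef
  set G := R + Bᵀ * X Kstar * B
  have hW (j : ℕ) := (hR.posSemidef.add (hPs.transpose_mul_mul_same B)).transpose_mul_mul_same
    (Kseq j - Kstar)
  have hlyap (j : ℕ) := (hV _ hKstar).excess_lyapunov hR hPs hstar (hV _ (hS j))
  have hD (j : ℕ) : (X (Kseq j) - X Kstar).PosSemidef :=
    (hS j).posSemidef_of_lyapunov (hW j) (hlyap j)
  have htrX : Antitone fun j => (X (Kseq j)).trace :=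
    antitone_nat_of_succ_le fun j => (hmono j).trace_le_trace
  set a := ‖B‖ * ‖A - B * Kstar‖ / r
  set b := ‖G‖ / q * (X (Kseq 0)).trace
  have ha : 0 ≤ a := by positivity
  have hb : 0 ≤ b := mul_nonneg (by positivity) (hP _ (hS 0)).trace_nonneg
  have htr (j : ℕ) : (X (Kseq j) - X Kstar).trace ≤ b * ‖Kseq j - Kstar‖ ^ 2 := by
    refine ((hV _ (hS j)).trace_le_of_lyapunov hR (hS j) hq hQq (hW j) (hlyap j)).trans ?_
    have hWtr : ((Kseq j - Kstar)ᵀ * G * (Kseq j - Kstar)).trace ≤ ‖G‖ * ‖Kseq j - Kstar‖ ^ 2 := by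
      rw [Matrix.mul_assoc, mul_comm, sq, mul_assoc, mul_comm ‖Kseq j - Kstar‖ ‖G‖]
      refine (trace_transpose_mul_le _ _).trans ?_
      rw [mul_comm ‖G‖]
      gcongr
      exact (frobenius_norm_mul _ _).trans_eq (mul_comm _ _)
    calc _ ≤ ‖G‖ * ‖Kseq j - Kstar‖ ^ 2 / q * (X (Kseq 0)).trace := by
          gcongr
          · exact (hP _ (hS j)).trace_nonneg
          · exact htrX (Nat.zero_le j)
      _ = b * ‖Kseq j - Kstar‖ ^ 2 := by ring
  have hgain (j : ℕ) : ‖Kseq (j + 1) - Kstar‖ ≤ a * (X (Kseq j) - X Kstar).trace :=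
    (norm_greedyGain_sub_le hr hRr (hP _ (hS j)) hstar (hgreedy j)).trans
      (mul_le_mul_of_nonneg_left (hD j).norm_le_trace ha)
  refine ⟨‖Sig‖ * (b * a ^ 2) / s ^ 2 + 1, by positivity, a * b + 1, by positivity, fun j => ?_⟩
  have hDj := (hD j).trace_nonneg
  constructor
  · rw [← trace_sub, ← trace_sub, ← Matrix.sub_mul, ← Matrix.sub_mul]
    set g := ((X (Kseq j) - X Kstar) * Sig).trace
    have hg : (X (Kseq j) - X Kstar).trace ≤ g / s := by
      rw [le_div_iff₀' hs]
      exact smul_trace_le_trace_mul (hD j) hSs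
    have hSigtr : ((X (Kseq (j + 1)) - X Kstar) * Sig).trace ≤
        ‖Sig‖ * (X (Kseq (j + 1)) - X Kstar).trace := by
      have h := trace_transpose_mul_le (X (Kseq (j + 1)) - X Kstar)ᵀ Sig
      rw [transpose_transpose, frobenius_norm_transpose, mul_comm] at h
      exact h.trans (mul_le_mul_of_nonneg_left (hD (j + 1)).norm_le_trace (norm_nonneg _))
    calc _ ≤ ‖Sig‖ * (X (Kseq (j + 1)) - X Kstar).trace := hSigtr
      _ ≤ ‖Sig‖ * (b * ‖Kseq (j + 1) - Kstar‖ ^ 2) := by gcongr; exact htr _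
      _ ≤ ‖Sig‖ * (b * (a * (X (Kseq j) - X Kstar).trace) ^ 2) := by gcongr; exact hgain j
      _ ≤ ‖Sig‖ * (b * (a * (g / s)) ^ 2) := by gcongr
      _ = ‖Sig‖ * (b * a ^ 2) / s ^ 2 * g ^ 2 := by ring
      _ ≤ _ := by gcongr; linarith
  · rw [frobNorm_eq_norm, frobNorm_eq_norm]
    calc _ ≤ a * (X (Kseq j) - X Kstar).trace := hgain j
      _ ≤ a * (b * ‖Kseq j - Kstar‖ ^ 2) := by gcongr; exact htr j
      _ = a * b * ‖Kseq j - Kstar‖ ^ 2 := by ring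
      _ ≤ _ := by gcongr; linarith
end

section
/- (Projected gradient descent for structured LQR: feasibility and sublinear convergence to a stationary point.) Let U be a linear subspace of ℝ^{m×n} with orthogonal projection P_U (with respect to the Frobenius inner product), and suppose K₀ ∈ K := U ∩ S. Let L > 0 be any constant such that the restriction of ∇f to the sublevel set S_{f(K₀)} = {K ∈ S : f(K) ≤ f(K₀)} is such that for all K in S_{f(K₀)} ∩ U the quadratic upper bound f(K') ≤ f(K) + ⟨∇f(K), K'−K⟩ + (L/2)‖K'−K‖_F² holds along segments in U contained in S_{f(K₀)} (e.g., L = sup over S_{f(K₀)} of the operator norm of the Hessian of f restricted to U). Define iterates K_{j+1} = K_j − (1/L) P_U(∇f(K_j)). Then every iterate K_j lies in K ∩ S_{f(K₀)} (in particular each K_j is Schur-stabilizing with the prescribed sparsity), the values f(K_j) are nonincreasing, and min_{0 ≤ j ≤ N} ‖P_U(∇f(K_j))‖_F² ≤ 2 L f(K₀) / (N+1) for every N; in particular ‖P_U(∇f(K_j))‖_F → 0 at rate O(1/√N). -/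
open Matrix

/-- The Frobenius inner product `⟨K, L⟩ = Tr(Kᵀ L)` of real matrices. -/
noncomputable def frobInner {a b : ℕ} (K L : Matrix (Fin a) (Fin b) ℝ) : ℝ :=
  Matrix.trace (Kᵀ * L)

/-- The gradient `∇f(K) = 2 (RK − BᵀX(K)(A−BK)) Y(K)` of the LQR cost. -/
noncomputable def gradLQR {n m : ℕ} (A : Matrix (Fin n) (Fin n) ℝ)
    (B : Matrix (Fin n) (Fin m) ℝ) (R : Matrix (Fin m) (Fin m) ℝ)
    (X Y : Matrix (Fin m) (Fin n) ℝ → Matrix (Fin n) (Fin n) ℝ)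
    (K : Matrix (Fin m) (Fin n) ℝ) : Matrix (Fin m) (Fin n) ℝ :=
  (2 : ℝ) • ((R * K - Bᵀ * X K * (A - B * K)) * Y K)

section SchurStability

open Filter Topology

open scoped Matrix.Norms.Operator ENNReal NNReal

theorem map_ofReal_pow {k : ℕ} (M : Matrix (Fin k) (Fin k) ℝ) (p : ℕ) :
    (M ^ p).map Complex.ofReal = M.map Complex.ofReal ^ p :=
  map_pow (Complex.ofRealHom.mapMatrix (m := Fin k)) M p

/-- The powers of a Schur stable matrix converge to zero. -/
theorem IsSchur.tendsto_pow {k : ℕ} [NeZero k] {M : Matrix (Fin k) (Fin k) ℝ} (hM : IsSchur M) :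
    Tendsto (fun p : ℕ => M ^ p) atTop (𝓝 0) := by
  set Mc : Matrix (Fin k) (Fin k) ℂ := M.map Complex.ofReal with hMc
  have hlt : spectralRadius ℂ Mc < ((1 : ℝ≥0) : ℝ≥0∞) :=
    spectrum.spectralRadius_lt_of_forall_lt Mc fun z hz => by
      have := hM z hz
      exact_mod_cast this
  obtain ⟨s, hs1, hs2⟩ := ENNReal.lt_iff_exists_nnreal_btwn.1 hlt
  have hev := (spectrum.pow_nnnorm_pow_one_div_tendsto_nhds_spectralRadius Mc).eventually_lt_const hs1
  have hs2' : s < 1 := by exact_mod_cast hs2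
  have hbd : ∀ᶠ p : ℕ in atTop, ‖Mc ^ p‖ ≤ (s : ℝ) ^ p := by
    filter_upwards [hev, eventually_gt_atTop 0] with p hp hp0
    have h1 : (‖Mc ^ p‖₊ : ℝ≥0∞) ≤ (s : ℝ≥0∞) ^ (p : ℝ) := by
      have := ENNReal.rpow_le_rpow hp.le (show (0 : ℝ) ≤ p by positivity)
      rwa [← ENNReal.rpow_mul, one_div_mul_cancel (by positivity), ENNReal.rpow_one] at this
    rw [ENNReal.rpow_natCast] at h1
    exact_mod_cast h1
  have h0 : Tendsto (fun p : ℕ => Mc ^ p) atTop (𝓝 0) :=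
    squeeze_zero_norm' hbd (tendsto_pow_atTop_nhds_zero_of_lt_one s.2 (by exact_mod_cast hs2'))
  have hre : Tendsto (fun p : ℕ => (Mc ^ p).map Complex.re) atTop
      (𝓝 ((0 : Matrix _ _ ℂ).map Complex.re)) :=
    ((continuous_id.matrix_map Complex.continuous_re).tendsto 0).comp h0
  have hpow : ∀ p : ℕ, (Mc ^ p).map Complex.re = M ^ p := fun p => by
    rw [hMc, ← map_ofReal_pow]
    ext i j
    simp
  simpa [hpow, Matrix.map_zero] using hre

/-- A matrix whose complexification has a power of operator norm less than one is Schur stable. -/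
theorem isSchur_of_norm_pow_lt_one {k : ℕ} [NeZero k] {M : Matrix (Fin k) (Fin k) ℝ} {p : ℕ}
    (h : ‖M.map Complex.ofReal ^ p‖ < 1) : IsSchur M := by
  intro μ hμ
  by_contra! hge
  have := spectrum.norm_le_norm_of_mem (spectrum.pow_mem_pow (M.map Complex.ofReal) p hμ)
  rw [norm_pow] at this
  exact absurd (this.trans_lt h) (not_lt.2 (one_le_pow₀ hge))

/-- Schur stability is an open condition. -/
theorem IsSchur.eventually {k : ℕ} [NeZero k] {M : Matrix (Fin k) (Fin k) ℝ} (hM : IsSchur M) :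
    ∀ᶠ N in 𝓝 M, IsSchur N := by
  have hc : Continuous fun N : Matrix (Fin k) (Fin k) ℝ => N.map Complex.ofReal :=
    continuous_id.matrix_map Complex.continuous_ofReal
  have h0 : Tendsto (fun p : ℕ => (M ^ p).map Complex.ofReal) atTop
      (𝓝 ((0 : Matrix (Fin k) (Fin k) ℝ).map Complex.ofReal)) :=
    (hc.tendsto 0).comp hM.tendsto_pow
  simp only [map_ofReal_pow] at h0
  have h1 := h0.norm
  rw [Matrix.map_zero _ Complex.ofReal_zero, norm_zero] at h1
  obtain ⟨p, hp⟩ := (h1.eventually_lt_const one_pos).exists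
  have hcp : Continuous fun N : Matrix (Fin k) (Fin k) ℝ => ‖N.map Complex.ofReal ^ p‖ :=
    (hc.pow p).norm
  filter_upwards [hcp.tendsto M |>.eventually_lt_const hp] with N hN
  exact isSchur_of_norm_pow_lt_one hN

/-- The homogeneous Stein equation has only the zero solution. -/
theorem stein_unique {k : ℕ} {M H : Matrix (Fin k) (Fin k) ℝ}
    (hM : Tendsto (fun p : ℕ => M ^ p) atTop (𝓝 0)) (hH : Mᵀ * H * M = H) : H = 0 := by
  have hp : ∀ p : ℕ, (M ^ p)ᵀ * H * M ^ p = H := by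
    intro p
    induction p with
    | zero => simp
    | succ p ih =>
      calc (M ^ (p + 1))ᵀ * H * M ^ (p + 1) = (M ^ p)ᵀ * (Mᵀ * H * M) * M ^ p := by
            rw [pow_succ', transpose_mul]; simp only [Matrix.mul_assoc]
        _ = H := by rw [hH, ih]
  have hlim : Tendsto (fun p : ℕ => (M ^ p)ᵀ * H * M ^ p) atTop
      (𝓝 ((0 : Matrix (Fin k) (Fin k) ℝ)ᵀ * H * 0)) := by
    have hc : Continuous fun N : Matrix (Fin k) (Fin k) ℝ => Nᵀ * H * N := by fun_prop
    exact (hc.tendsto 0).comp hM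
  simp only [hp] at hlim
  simpa using tendsto_nhds_unique tendsto_const_nhds hlim

theorem Matrix.PosSemidef.of_tendsto {k : ℕ} {H : ℕ → Matrix (Fin k) (Fin k) ℝ}
    {H₀ : Matrix (Fin k) (Fin k) ℝ} (hH : ∀ p, (H p).PosSemidef)
    (hlim : Tendsto H atTop (𝓝 H₀)) : H₀.PosSemidef := by
  refine .of_dotProduct_mulVec_nonneg ?_ fun x => ?_
  · have hc : Continuous fun N : Matrix (Fin k) (Fin k) ℝ => Nᴴ := by fun_prop
    have h1 := (hc.tendsto H₀).comp hlim
    refine tendsto_nhds_unique (h1.congr fun p => ?_) hlim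
    exact (hH p).1
  · have hc : Continuous fun N : Matrix (Fin k) (Fin k) ℝ => star x ⬝ᵥ N *ᵥ x := by fun_prop
    exact ge_of_tendsto' ((hc.tendsto H₀).comp hlim) fun p => (hH p).dotProduct_mulVec_nonneg x

theorem stein_posSemidef {k : ℕ} {M H W : Matrix (Fin k) (Fin k) ℝ}
    (hM : Tendsto (fun p : ℕ => M ^ p) atTop (𝓝 0)) (hH : Mᵀ * H * M + W = H)
    (hW : W.PosSemidef) : H.PosSemidef := by
  have hp : ∀ p : ℕ, (H - (M ^ p)ᵀ * H * M ^ p).PosSemidef := by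
    intro p
    induction p with
    | zero => simpa using Matrix.PosSemidef.zero
    | succ p ih =>
      have : H - (M ^ (p + 1))ᵀ * H * M ^ (p + 1)
          = (H - (M ^ p)ᵀ * H * M ^ p) + (M ^ p)ᴴ * W * M ^ p := by
        have e : W = H - Mᵀ * H * M := by rw [← sub_eq_of_eq_add' hH.symm]
        rw [e, pow_succ', transpose_mul, conjTranspose_eq_transpose_of_trivial]
        simp only [Matrix.mul_sub, Matrix.sub_mul, Matrix.mul_assoc]
        abel
      rw [this]
      exact ih.add (hW.conjTranspose_mul_mul_same _)
  refine Matrix.PosSemidef.of_tendsto hp ?_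
  have hc : Continuous fun N : Matrix (Fin k) (Fin k) ℝ => H - Nᵀ * H * N := by fun_prop
  simpa [Function.comp_def] using (hc.tendsto 0).comp hM

theorem tendsto_pow_transpose {k : ℕ} {M : Matrix (Fin k) (Fin k) ℝ}
    (hM : Tendsto (fun p : ℕ => M ^ p) atTop (𝓝 0)) :
    Tendsto (fun p : ℕ => Mᵀ ^ p) atTop (𝓝 0) := by
  have hc : Continuous fun N : Matrix (Fin k) (Fin k) ℝ => Nᵀ := by fun_prop
  simpa [Function.comp_def, transpose_pow] using (hc.tendsto 0).comp hM

/-- Lyapunov's criterion for Schur stability. -/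
theorem isSchur_of_stein {k : ℕ} {M H W : Matrix (Fin k) (Fin k) ℝ}
    (hH : Mᵀ * H * M + W = H) (hHp : H.PosSemidef) (hW : W.PosDef) : IsSchur M := by
  intro μ hμ
  rw [← Matrix.spectrum_toLin', ← Module.End.hasEigenvalue_iff_mem_spectrum] at hμ
  obtain ⟨v, hv⟩ := hμ.exists_hasEigenvector
  have hmv : (M.map Complex.ofReal) *ᵥ v = μ • v := by
    simpa using hv.apply_eq_smul
  set a : Fin k → ℝ := fun i => (v i).re with ha
  set b : Fin k → ℝ := fun i => (v i).im with hb
  have hMa : M *ᵥ a = μ.re • a - μ.im • b := by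
    ext i
    have := congrArg Complex.re (congrFun hmv i)
    simpa [mulVec, dotProduct, Complex.re_sum] using this
  have hMb : M *ᵥ b = μ.re • b + μ.im • a := by
    ext i
    have := congrArg Complex.im (congrFun hmv i)
    simpa [mulVec, dotProduct, Complex.im_sum] using this
  have hquad : ∀ x : Fin k → ℝ,
      (M *ᵥ x) ⬝ᵥ H *ᵥ (M *ᵥ x) + x ⬝ᵥ W *ᵥ x = x ⬝ᵥ H *ᵥ x := by
    intro x
    conv_rhs => rw [← hH]
    rw [add_mulVec, dotProduct_add, ← mulVec_mulVec, ← mulVec_mulVec,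
      dotProduct_mulVec x Mᵀ, vecMul_transpose]
  have h1 := hquad a
  have h2 := hquad b
  rw [hMa] at h1
  rw [hMb] at h2
  simp only [mulVec_sub, mulVec_add, mulVec_smul, dotProduct_sub, dotProduct_add, sub_dotProduct,
    add_dotProduct, smul_dotProduct, dotProduct_smul, smul_eq_mul] at h1 h2
  have hpa : 0 ≤ a ⬝ᵥ H *ᵥ a := by simpa using hHp.dotProduct_mulVec_nonneg a
  have hpb : 0 ≤ b ⬝ᵥ H *ᵥ b := by simpa using hHp.dotProduct_mulVec_nonneg b
  have hwa : 0 ≤ a ⬝ᵥ W *ᵥ a := by simpa using hW.posSemidef.dotProduct_mulVec_nonneg a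
  have hwb : 0 ≤ b ⬝ᵥ W *ᵥ b := by simpa using hW.posSemidef.dotProduct_mulVec_nonneg b
  have hpos : 0 < a ⬝ᵥ W *ᵥ a + b ⬝ᵥ W *ᵥ b := by
    by_cases haz : a = 0
    · have hbz : b ≠ 0 := by
        intro hbz
        refine hv.2 (funext fun i => Complex.ext ?_ ?_)
        · exact congrFun haz i
        · exact congrFun hbz i
      have : 0 < b ⬝ᵥ W *ᵥ b := by simpa using hW.dotProduct_mulVec_pos hbz
      linarith
    · have : 0 < a ⬝ᵥ W *ᵥ a := by simpa using hW.dotProduct_mulVec_pos haz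
      linarith
  have hkey : (μ.re ^ 2 + μ.im ^ 2) * (a ⬝ᵥ H *ᵥ a + b ⬝ᵥ H *ᵥ b)
      + (a ⬝ᵥ W *ᵥ a + b ⬝ᵥ W *ᵥ b) = a ⬝ᵥ H *ᵥ a + b ⬝ᵥ H *ᵥ b := by linarith
  have hsq : μ.re ^ 2 + μ.im ^ 2 < 1 := by
    by_contra! h
    nlinarith
  have hnorm : ‖μ‖ ^ 2 < 1 := by
    rw [Complex.sq_norm, Complex.normSq_apply]
    nlinarith
  nlinarith [norm_nonneg μ]

/-- Locally unique solutions of `P H Q + W = H` in a finite-dimensional algebra depend continuously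
on `P` and `Q`. -/
theorem tendsto_sylvester {E : Type*} [NormedRing E] [NormedAlgebra ℝ E] [FiniteDimensional ℝ E]
    {P Q : ℝ → E} (hP : ContinuousAt P 0) (hQ : ContinuousAt Q 0)
    (hinj : ∀ V, P 0 * V * Q 0 = V → V = 0) (W : E) (H : ℝ → E)
    (hH : ∀ᶠ t in 𝓝 (0 : ℝ), P t * H t * Q t + W = H t) :
    Tendsto H (𝓝 0) (𝓝 (H 0)) := by
  have := FiniteDimensional.complete ℝ E
  let T : ℝ → E →L[ℝ] E := fun t =>
    1 - (ContinuousLinearMap.mul ℝ E (P t)).comp ((ContinuousLinearMap.mul ℝ E).flip (Q t))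
  have hT : ∀ t V, T t V = V - P t * V * Q t := fun t V => by
    simp [T, mul_assoc]
  have hTc : ContinuousAt T 0 := by fun_prop
  have hker : Function.Injective (T 0) := by
    rw [injective_iff_map_eq_zero]
    intro V hV
    rw [hT, sub_eq_zero] at hV
    exact hinj V hV.symm
  have hunit : IsUnit (T 0) := by
    rw [ContinuousLinearMap.isUnit_iff_bijective]
    exact ⟨hker, (LinearMap.injective_iff_surjective (f := (T 0).toLinearMap)).1 hker⟩
  have hinvT : Tendsto (fun t => Ring.inverse (T t) W) (𝓝 0) (𝓝 (Ring.inverse (T 0) W)) := by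
    have h2 : Tendsto (fun t => Ring.inverse (T t)) (𝓝 0) (𝓝 (Ring.inverse (T 0))) := by
      obtain ⟨u, hu⟩ := hunit
      have hc := NormedRing.inverse_continuousAt u
      rw [hu] at hc
      exact hc.tendsto.comp hTc
    have hc : Continuous fun S : E →L[ℝ] E => S W := by fun_prop
    exact (hc.tendsto _).comp h2
  have hev : ∀ᶠ t in 𝓝 (0 : ℝ), Ring.inverse (T t) W = H t := by
    have hu : ∀ᶠ S in 𝓝 (T 0), IsUnit S := Units.isOpen.mem_nhds hunit
    filter_upwards [hH, hTc.tendsto.eventually hu] with t ht htu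
    have : T t (H t) = W := by
      rw [hT, sub_eq_iff_eq_add', ht]
    rw [← this]
    change (Ring.inverse (T t) * T t) (H t) = H t
    rw [Ring.inverse_mul_cancel _ htu]
    rfl
  have h0 : Ring.inverse (T 0) W = H 0 := hev.self_of_nhds
  rw [← h0]
  exact Tendsto.congr' hev hinvT

/-- Solutions of the Stein equation depend continuously on the data. -/
theorem tendsto_stein {k : ℕ} {M N : Matrix (Fin k) (Fin k) ℝ}
    (hM : Tendsto (fun p : ℕ => M ^ p) atTop (𝓝 0)) (W : Matrix (Fin k) (Fin k) ℝ)
    (H : ℝ → Matrix (Fin k) (Fin k) ℝ)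
    (hH : ∀ᶠ t in 𝓝 (0 : ℝ), (M + t • N) * H t * (M + t • N)ᵀ + W = H t) :
    Tendsto H (𝓝 0) (𝓝 (H 0)) := by
  have hP : Continuous fun t : ℝ => M + t • N := by fun_prop
  have hQ : Continuous fun t : ℝ => (M + t • N)ᵀ := by fun_prop
  refine tendsto_sylvester hP.continuousAt hQ.continuousAt (fun V hV => ?_) W H hH
  refine stein_unique (tendsto_pow_transpose hM) ?_
  simpa using hV

end SchurStability

section FrobeniusInner

theorem frobInner_eq_sum {a b : ℕ} (K L : Matrix (Fin a) (Fin b) ℝ) :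
    frobInner K L = ∑ j, ∑ i, K i j * L i j := by
  simp [frobInner, trace, Matrix.mul_apply]

theorem frobInner_self_nonneg {a b : ℕ} (K : Matrix (Fin a) (Fin b) ℝ) : 0 ≤ frobInner K K := by
  rw [frobInner_eq_sum]
  exact Finset.sum_nonneg fun j _ => Finset.sum_nonneg fun i _ => mul_self_nonneg _

theorem frobInner_self_eq_zero {a b : ℕ} {K : Matrix (Fin a) (Fin b) ℝ} (h : frobInner K K = 0) :
    K = 0 := by
  refine (Matrix.trace_conjTranspose_mul_self_eq_zero_iff (A := K)).1 ?_
  rwa [conjTranspose_eq_transpose_of_trivial]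

theorem frobInner_sub_left {a b : ℕ} (K L W : Matrix (Fin a) (Fin b) ℝ) :
    frobInner (K - L) W = frobInner K W - frobInner L W := by
  simp [frobInner, transpose_sub, Matrix.sub_mul]

theorem frobInner_smul_left {a b : ℕ} (r : ℝ) (K W : Matrix (Fin a) (Fin b) ℝ) :
    frobInner (r • K) W = r * frobInner K W := by
  simp [frobInner]

theorem frobInner_smul_right {a b : ℕ} (r : ℝ) (K W : Matrix (Fin a) (Fin b) ℝ) :
    frobInner K (r • W) = r * frobInner K W := by
  simp [frobInner]

end FrobeniusInner

section PositiveSemidefinite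

open scoped MatrixOrder

theorem Matrix.PosSemidef.exists_eq_transpose_mul_self_s19 {k : ℕ} {S : Matrix (Fin k) (Fin k) ℝ}
    (hS : S.PosSemidef) : ∃ C : Matrix (Fin k) (Fin k) ℝ, S = Cᵀ * C := by
  open scoped Matrix.Norms.L2Operator in
  obtain ⟨C, hC⟩ := CStarAlgebra.nonneg_iff_eq_star_mul_self.mp hS.nonneg
  exact ⟨C, by rw [hC, star_eq_conjTranspose, conjTranspose_eq_transpose_of_trivial]⟩

theorem Matrix.PosSemidef.mul_mul_transpose_same {k : ℕ} {X : Matrix (Fin k) (Fin k) ℝ}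
    (hX : X.PosSemidef) (C : Matrix (Fin k) (Fin k) ℝ) : (C * X * Cᵀ).PosSemidef := by
  simpa using hX.mul_mul_conjTranspose_same C

theorem Matrix.PosSemidef.transpose_eq {k : ℕ} {X : Matrix (Fin k) (Fin k) ℝ}
    (hX : X.PosSemidef) : Xᵀ = X := by
  simpa [IsHermitian] using hX.1

theorem trace_mul_transpose_mul_self {k : ℕ} (X C : Matrix (Fin k) (Fin k) ℝ) :
    trace (X * (Cᵀ * C)) = trace (C * X * Cᵀ) := by
  rw [← Matrix.mul_assoc, trace_mul_comm, Matrix.mul_assoc]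

theorem Matrix.PosSemidef.trace_mul_nonneg_s19 {k : ℕ} {X S : Matrix (Fin k) (Fin k) ℝ}
    (hX : X.PosSemidef) (hS : S.PosSemidef) : 0 ≤ trace (X * S) := by
  obtain ⟨C, rfl⟩ := hS.exists_eq_transpose_mul_self_s19
  rw [trace_mul_transpose_mul_self]
  exact (hX.mul_mul_transpose_same C).trace_nonneg

theorem Matrix.PosSemidef.abs_apply_le_trace {k : ℕ} {Z : Matrix (Fin k) (Fin k) ℝ}
    (hZ : Z.PosSemidef) (i j : Fin k) : |Z i j| ≤ trace Z := by
  have hd : ∀ l, Z l l ≤ trace Z := fun l =>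
    Finset.single_le_sum (f := fun l => Z l l) (fun l _ => hZ.diag_nonneg) (Finset.mem_univ l)
  have hs : Z j i = Z i j := congrFun (congrFun hZ.transpose_eq i) j
  have hp := hZ.dotProduct_mulVec_nonneg (Pi.single i 1 + Pi.single j 1)
  have hm := hZ.dotProduct_mulVec_nonneg (Pi.single i 1 - Pi.single j 1)
  simp [mulVec_add, mulVec_sub] at hp hm
  rw [abs_le]
  constructor <;> linarith [hd i, hd j]

end PositiveSemidefinite

section LinearQuadraticRegulator

open Filter Topology

variable {n m : ℕ} {A : Matrix (Fin n) (Fin n) ℝ} {B : Matrix (Fin n) (Fin m) ℝ}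
  {Q Sig : Matrix (Fin n) (Fin n) ℝ} {R : Matrix (Fin m) (Fin m) ℝ}
  {X Y : Matrix (Fin m) (Fin n) ℝ → Matrix (Fin n) (Fin n) ℝ}

theorem posDef_stageCost (hQ : Q.PosDef) (hR : R.PosDef) (K : Matrix (Fin m) (Fin n) ℝ) :
    (Kᵀ * R * K + Q).PosDef := by
  refine Matrix.PosDef.posSemidef_add ?_ hQ
  simpa using hR.posSemidef.conjTranspose_mul_mul_same K

/-- The value matrix of a stabilizing gain is positive semidefinite. -/
theorem valueMatrix_posSemidef [NeZero n] (hQ : Q.PosDef) (hR : R.PosDef)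
    (hX : ∀ K, IsSchur (A - B * K) →
      (A - B * K)ᵀ * X K * (A - B * K) + Kᵀ * R * K + Q = X K)
    {K : Matrix (Fin m) (Fin n) ℝ} (hK : IsSchur (A - B * K)) : (X K).PosSemidef :=
  stein_posSemidef hK.tendsto_pow (by rw [← add_assoc, hX K hK])
    (posDef_stageCost hQ hR K).posSemidef

theorem covariance_posSemidef [NeZero n] (hSig : Sig.PosDef)
    (hY : ∀ K, IsSchur (A - B * K) → (A - B * K) * Y K * (A - B * K)ᵀ + Sig = Y K)
    {K : Matrix (Fin m) (Fin n) ℝ} (hK : IsSchur (A - B * K)) : (Y K).PosSemidef :=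
  stein_posSemidef (tendsto_pow_transpose hK.tendsto_pow) (by rw [transpose_transpose, hY K hK])
    hSig.posSemidef

/-- The exact second-order expansion of the LQR cost along a line. -/
theorem cost_line_eq {X₀ X₁ Y₁ : Matrix (Fin n) (Fin n) ℝ} {K D : Matrix (Fin m) (Fin n) ℝ} {t : ℝ}
    (hXs : X₀ᵀ = X₀) (hRs : Rᵀ = R)
    (h₀ : (A - B * K)ᵀ * X₀ * (A - B * K) + Kᵀ * R * K + Q = X₀)
    (h₁ : (A - B * (K + t • D))ᵀ * X₁ * (A - B * (K + t • D))
      + (K + t • D)ᵀ * R * (K + t • D) + Q = X₁)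
    (hY₁ : (A - B * (K + t • D)) * Y₁ * (A - B * (K + t • D))ᵀ + Sig = Y₁) :
    trace (X₁ * Sig) = trace (X₀ * Sig) +
      t * (trace ((Dᵀ * (R * K - Bᵀ * X₀ * (A - B * K))
          + (R * K - Bᵀ * X₀ * (A - B * K))ᵀ * D) * Y₁)
        + t * trace (Dᵀ * (R + Bᵀ * X₀ * B) * D * Y₁)) := by
  set M := A - B * K with hM
  have hM' : A - B * (K + t • D) = M - t • (B * D) := by
    rw [Matrix.mul_add, Matrix.mul_smul, hM]
    abel
  rw [hM'] at h₁ hY₁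
  set E := R * K - Bᵀ * X₀ * M with hE
  have hEt : Eᵀ = Kᵀ * R - Mᵀ * X₀ * B := by
    simp [hE, transpose_mul, hXs, hRs, Matrix.mul_assoc]
  set M' := M - t • (B * D) with hM'd
  have hΔ : (X₁ - X₀) - M'ᵀ * (X₁ - X₀) * M'
      = t • (Dᵀ * E + Eᵀ * D) + (t * t) • (Dᵀ * (R + Bᵀ * X₀ * B) * D) := by
    have e1 : (X₁ - X₀) - M'ᵀ * (X₁ - X₀) * M' = (X₁ - M'ᵀ * X₁ * M') - (X₀ - M'ᵀ * X₀ * M') := by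
      simp only [Matrix.mul_sub, Matrix.sub_mul]
      abel
    have e2 : X₁ - M'ᵀ * X₁ * M' = (K + t • D)ᵀ * R * (K + t • D) + Q := by
      rw [sub_eq_iff_eq_add', ← add_assoc, h₁]
    have e3 : X₀ - M'ᵀ * X₀ * M' = Mᵀ * X₀ * M + Kᵀ * R * K + Q - M'ᵀ * X₀ * M' := by rw [h₀]
    rw [e1, e2, e3, hEt, hE, hM'd]
    simp only [transpose_add, transpose_sub, transpose_smul, transpose_mul, Matrix.add_mul,
      Matrix.mul_add, Matrix.sub_mul, Matrix.mul_sub, Matrix.smul_mul, Matrix.mul_smul,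
      Matrix.mul_assoc, smul_add, smul_sub, smul_smul]
    abel
  have htr : trace ((X₁ - X₀) * Sig) = trace (((X₁ - X₀) - M'ᵀ * (X₁ - X₀) * M') * Y₁) := by
    have hSig : Sig = Y₁ - M' * Y₁ * M'ᵀ := by rw [eq_sub_iff_add_eq', hY₁]
    clear_value M'
    generalize X₁ - X₀ = V
    rw [hSig, Matrix.mul_sub, Matrix.sub_mul, trace_sub, trace_sub]
    congr 1
    rw [← Matrix.mul_assoc V, trace_mul_comm]
    simp only [Matrix.mul_assoc]
  rw [hΔ, Matrix.sub_mul, trace_sub] at htr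
  rw [Matrix.add_mul, trace_add, Matrix.smul_mul, Matrix.smul_mul, trace_smul, trace_smul,
    smul_eq_mul, smul_eq_mul] at htr
  linear_combination htr

/-- First-order expansion of the LQR cost: the derivative at `K` in direction `D` is
`⟨∇f(K), D⟩`. -/
theorem exists_slope_cost [NeZero n] (hQ : Q.PosDef) (hR : R.PosDef) (hSig : Sig.PosDef)
    (hX : ∀ K, IsSchur (A - B * K) →
      (A - B * K)ᵀ * X K * (A - B * K) + Kᵀ * R * K + Q = X K)
    (hY : ∀ K, IsSchur (A - B * K) → (A - B * K) * Y K * (A - B * K)ᵀ + Sig = Y K)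
    {K : Matrix (Fin m) (Fin n) ℝ} (hK : IsSchur (A - B * K)) (D : Matrix (Fin m) (Fin n) ℝ) :
    ∃ g : ℝ → ℝ, Tendsto g (𝓝 0) (𝓝 (frobInner (gradLQR A B R X Y K) D)) ∧
      ∀ᶠ t in 𝓝 (0 : ℝ), IsSchur (A - B * (K + t • D)) ∧
        trace (X (K + t • D) * Sig) = trace (X K * Sig) + t * g t := by
  have hXs := (valueMatrix_posSemidef hQ hR hX hK).transpose_eq
  have hYs := (covariance_posSemidef hSig hY hK).transpose_eq
  have hev : ∀ᶠ t in 𝓝 (0 : ℝ), IsSchur (A - B * (K + t • D)) := by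
    have hc : Continuous fun t : ℝ => A - B * (K + t • D) := by fun_prop
    have := hc.tendsto 0
    rw [zero_smul, add_zero] at this
    exact this.eventually hK.eventually
  have hYlim : Tendsto (fun t : ℝ => Y (K + t • D)) (𝓝 0) (𝓝 (Y K)) := by
    have := tendsto_stein (N := -(B * D)) hK.tendsto_pow Sig (fun t : ℝ => Y (K + t • D)) (by
      filter_upwards [hev] with t ht
      have e : A - B * K + t • -(B * D) = A - B * (K + t • D) := by
        rw [Matrix.mul_add, Matrix.mul_smul, smul_neg]
        abel
      rw [e]
      exact hY _ ht)
    simpa using this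
  refine ⟨fun t => trace ((Dᵀ * (R * K - Bᵀ * X K * (A - B * K))
          + (R * K - Bᵀ * X K * (A - B * K))ᵀ * D) * Y (K + t • D))
        + t * trace (Dᵀ * (R + Bᵀ * X K * B) * D * Y (K + t • D)), ?_, ?_⟩
  · have hc : ∀ C : Matrix (Fin n) (Fin n) ℝ,
        Tendsto (fun t : ℝ => trace (C * Y (K + t • D))) (𝓝 0) (𝓝 (trace (C * Y K))) := fun C => by
      have h : Continuous fun V : Matrix (Fin n) (Fin n) ℝ => trace (C * V) := by fun_prop
      exact (h.tendsto _).comp hYlim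
    refine ((hc _).add (tendsto_id.mul (hc _))).trans_eq ?_
    congr 1
    set E := R * K - Bᵀ * X K * (A - B * K) with hE
    have h1 : trace (Dᵀ * E * Y K) = trace ((E * Y K)ᵀ * D) := by
      rw [← trace_transpose, Matrix.mul_assoc, transpose_mul, transpose_transpose]
    have h2 : trace (Eᵀ * D * Y K) = trace ((E * Y K)ᵀ * D) := by
      rw [transpose_mul, hYs, Matrix.mul_assoc (Y K), trace_mul_comm]
    rw [zero_mul, add_zero, Matrix.add_mul, trace_add, h1, h2, gradLQR, frobInner_smul_left,
      frobInner]
    ring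
  · filter_upwards [hev] with t ht
    exact ⟨ht, cost_line_eq hXs (by simpa using hR.posSemidef.transpose_eq) (hX K hK) (hX _ ht)
      (hY _ ht)⟩

/-- Sublevel sets of the LQR cost are closed: a limit of stabilizing gains of bounded cost is
stabilizing and satisfies the same bound. -/
theorem sublevel_of_tendsto [NeZero n] (hQ : Q.PosDef) (hR : R.PosDef) (hSig : Sig.PosDef)
    (hX : ∀ K, IsSchur (A - B * K) →
      (A - B * K)ᵀ * X K * (A - B * K) + Kᵀ * R * K + Q = X K)
    {c : ℝ} {Ks : ℕ → Matrix (Fin m) (Fin n) ℝ} {K : Matrix (Fin m) (Fin n) ℝ}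
    (hKs : ∀ p, IsSchur (A - B * Ks p) ∧ trace (X (Ks p) * Sig) ≤ c)
    (hlim : Tendsto Ks atTop (𝓝 K)) :
    IsSchur (A - B * K) ∧ trace (X K * Sig) ≤ c := by
  obtain ⟨C, hC⟩ := hSig.posSemidef.exists_eq_transpose_mul_self_s19
  have hCu : IsUnit C.det := by
    have h := hSig.det_pos.ne'
    rw [hC, det_mul, det_transpose] at h
    exact (left_ne_zero_of_mul h).isUnit
  have hpsd : ∀ p, (X (Ks p)).PosSemidef := fun p => valueMatrix_posSemidef hQ hR hX (hKs p).1
  have hcomp : IsCompact (Set.univ.pi fun _ : Fin n => Set.univ.pi fun _ : Fin n => Set.Icc (-c) c) :=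
    isCompact_univ_pi fun _ => isCompact_univ_pi fun _ => isCompact_Icc
  obtain ⟨Z, -, φ, hφ, hZ⟩ := hcomp.tendsto_subseq
    (x := fun p => (fun i j => (C * X (Ks p) * Cᵀ) i j : Fin n → Fin n → ℝ)) fun p => by
    intro i _ j _
    have h1 := ((hpsd p).mul_mul_transpose_same C).abs_apply_le_trace i j
    rw [← trace_mul_transpose_mul_self, ← hC] at h1
    exact abs_le.1 (h1.trans (hKs p).2)
  have hXlim : Tendsto (fun p => X (Ks (φ p))) atTop (𝓝 (C⁻¹ * of Z * C⁻¹ᵀ)) := by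
    have hc : Continuous fun V : Matrix (Fin n) (Fin n) ℝ => C⁻¹ * V * C⁻¹ᵀ := by fun_prop
    refine ((hc.tendsto (of Z)).comp hZ).congr fun p => ?_
    have hCt : Cᵀ * C⁻¹ᵀ = 1 := by
      rw [← transpose_mul, Matrix.nonsing_inv_mul _ hCu, transpose_one]
    calc C⁻¹ * (C * X (Ks (φ p)) * Cᵀ) * C⁻¹ᵀ = C⁻¹ * C * X (Ks (φ p)) * (Cᵀ * C⁻¹ᵀ) := by
          simp only [Matrix.mul_assoc]
      _ = X (Ks (φ p)) := by rw [hCt, Matrix.nonsing_inv_mul _ hCu, Matrix.one_mul, Matrix.mul_one]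
  set X₀ := C⁻¹ * of Z * C⁻¹ᵀ
  have hX₀ : X₀.PosSemidef := Matrix.PosSemidef.of_tendsto (fun p => hpsd (φ p)) hXlim
  have heq : (A - B * K)ᵀ * X₀ * (A - B * K) + (Kᵀ * R * K + Q) = X₀ := by
    have hKφ := hlim.comp hφ.tendsto_atTop
    have hc : Continuous fun V : Matrix (Fin m) (Fin n) ℝ × Matrix (Fin n) (Fin n) ℝ =>
        (A - B * V.1)ᵀ * V.2 * (A - B * V.1) + (V.1ᵀ * R * V.1 + Q) := by fun_prop
    have h1 := (hc.tendsto (K, X₀)).comp (hKφ.prodMk_nhds hXlim)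
    refine tendsto_nhds_unique (h1.congr fun p => ?_) hXlim
    simpa [add_assoc] using hX _ (hKs (φ p)).1
  have hS : IsSchur (A - B * K) := isSchur_of_stein heq hX₀ (posDef_stageCost hQ hR K)
  refine ⟨hS, ?_⟩
  have hXK : X K = X₀ := by
    rw [← sub_eq_zero]
    refine stein_unique hS.tendsto_pow ?_
    have h1 := hX K hS
    rw [add_assoc] at h1
    calc (A - B * K)ᵀ * (X K - X₀) * (A - B * K)
        = ((A - B * K)ᵀ * X K * (A - B * K) + (Kᵀ * R * K + Q))
          - ((A - B * K)ᵀ * X₀ * (A - B * K) + (Kᵀ * R * K + Q)) := by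
          simp only [Matrix.mul_sub, Matrix.sub_mul]
          abel
      _ = X K - X₀ := by rw [h1, heq]
  rw [hXK]
  have hc : Continuous fun V : Matrix (Fin n) (Fin n) ℝ => trace (V * Sig) := by fun_prop
  exact le_of_tendsto' ((hc.tendsto X₀).comp hXlim) fun p => (hKs (φ p)).2

end LinearQuadraticRegulator

section Descent

open Filter Topology Set

/-- A property of points of `[0, b]` that is sequentially closed and locally extends to the right
of any initial segment on which it holds, holds on all of `[0, b]`. -/
theorem forall_mem_Icc_of_extends {p : ℝ → Prop} {b : ℝ} (h0 : p 0)
    (hclosed : ∀ (u : ℕ → ℝ) (x : ℝ), (∀ k, p (u k)) → Tendsto u atTop (𝓝 x) → p x)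
    (hext : ∀ x ∈ Icc 0 b, (∀ y ∈ Icc 0 x, p y) → ∀ᶠ y in 𝓝[>] x, p y) :
    ∀ x ∈ Icc 0 b, p x := by
  by_contra! hbad
  obtain ⟨x, hx, hpx⟩ := hbad
  set s : Set ℝ := {y | y ∈ Icc 0 b ∧ ¬ p y} with hs
  have hne : s.Nonempty := ⟨x, hx, hpx⟩
  have hbdd : BddBelow s := ⟨0, fun y hy => hy.1.1⟩
  set w := sInf s with hw
  have hw0 : 0 ≤ w := le_csInf hne fun y hy => hy.1.1
  have hwb : w ≤ b := (csInf_le hbdd ⟨hx, hpx⟩).trans hx.2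
  have hlt : ∀ y, 0 ≤ y → y < w → p y := fun y hy0 hyw => by
    by_contra hpy
    exact notMem_of_lt_csInf hyw hbdd ⟨⟨hy0, hyw.le.trans hwb⟩, hpy⟩
  have hpw : p w := by
    rcases hw0.eq_or_lt with h | h
    · exact h ▸ h0
    · obtain ⟨u, -, hu, hlim⟩ := exists_seq_strictMono_tendsto' h
      exact hclosed u w (fun k => hlt _ (hu k).1.le (hu k).2) hlim
  have hle : ∀ y ∈ Icc 0 w, p y := fun y hy => by
    rcases hy.2.eq_or_lt with h | h
    · exact h ▸ hpw
    · exact hlt y hy.1 h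
  obtain ⟨v, hv, hvp⟩ := mem_nhdsGT_iff_exists_Ioo_subset.1 (hext w ⟨hw0, hwb⟩ hle)
  obtain ⟨y, hys, hyv⟩ := exists_lt_of_csInf_lt hne hv
  have hwy : w < y := lt_of_le_of_ne (csInf_le hbdd hys) fun h => hys.2 (h ▸ hpw)
  exact hys.2 (hvp ⟨hwy, hyv⟩)

variable {n m : ℕ} {A : Matrix (Fin n) (Fin n) ℝ} {B : Matrix (Fin n) (Fin m) ℝ}
  {Q Sig : Matrix (Fin n) (Fin n) ℝ} {R : Matrix (Fin m) (Fin m) ℝ}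
  {X Y : Matrix (Fin m) (Fin n) ℝ → Matrix (Fin n) (Fin n) ℝ}

/-- One projected gradient step from a gain in the sublevel set stays in it, and decreases the cost
by at least `‖G‖² / (2L)`, where `G` is the projected gradient. -/
theorem projected_gradient_step [NeZero n] (hQ : Q.PosDef) (hR : R.PosDef) (hSig : Sig.PosDef)
    (hX : ∀ K, IsSchur (A - B * K) →
      (A - B * K)ᵀ * X K * (A - B * K) + Kᵀ * R * K + Q = X K)
    (hY : ∀ K, IsSchur (A - B * K) → (A - B * K) * Y K * (A - B * K)ᵀ + Sig = Y K)
    {U : Submodule ℝ (Matrix (Fin m) (Fin n) ℝ)} {L c : ℝ} (hL : 0 < L)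
    {K G : Matrix (Fin m) (Fin n) ℝ} (hKU : K ∈ U) (hKS : IsSchur (A - B * K))
    (hKc : trace (X K * Sig) ≤ c) (hGU : G ∈ U)
    (hG : frobInner (gradLQR A B R X Y K) G = frobInner G G)
    (hquad : ∀ K' ∈ U,
      (∀ t ∈ Icc (0 : ℝ) 1, IsSchur (A - B * (K + t • (K' - K))) ∧
        trace (X (K + t • (K' - K)) * Sig) ≤ c) →
      trace (X K' * Sig) ≤ trace (X K * Sig) + frobInner (gradLQR A B R X Y K) (K' - K)
        + L / 2 * frobInner (K' - K) (K' - K)) :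
    K - (1 / L) • G ∈ U ∧ IsSchur (A - B * (K - (1 / L) • G)) ∧
      trace (X (K - (1 / L) • G) * Sig) ≤ c ∧
      trace (X (K - (1 / L) • G) * Sig) ≤ trace (X K * Sig) - frobInner G G / (2 * L) := by
  have hLinv : 0 < 1 / L := one_div_pos.2 hL
  have hmem : ∀ t : ℝ, K - t • G ∈ U := fun t => U.sub_mem hKU (U.smul_mem t hGU)
  have hdesc : ∀ x : ℝ, 0 ≤ x →
      (∀ y ∈ Icc 0 x, IsSchur (A - B * (K - y • G)) ∧ trace (X (K - y • G) * Sig) ≤ c) →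
      trace (X (K - x • G) * Sig) ≤ trace (X K * Sig) - x * (1 - L * x / 2) * frobInner G G := by
    intro x hx hseg
    have h := hquad (K - x • G) (hmem x) fun t ht => by
      have e : K + t • (K - x • G - K) = K - (t * x) • G := by
        rw [sub_sub_cancel_left, smul_neg, smul_smul, ← sub_eq_add_neg]
      rw [e]
      exact hseg _ ⟨mul_nonneg ht.1 hx, mul_le_of_le_one_left hx ht.2⟩
    have e : K - x • G - K = (-x) • G := by rw [sub_sub_cancel_left, neg_smul]
    rw [e, frobInner_smul_right, frobInner_smul_right, frobInner_smul_left, hG] at h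
    linarith
  have hall : ∀ x ∈ Icc (0 : ℝ) (1 / L),
      IsSchur (A - B * (K - x • G)) ∧ trace (X (K - x • G) * Sig) ≤ c := by
    rcases (frobInner_self_nonneg G).eq_or_lt with hz | hpos
    · intro x _
      rw [frobInner_self_eq_zero hz.symm, smul_zero, sub_zero]
      exact ⟨hKS, hKc⟩
    refine forall_mem_Icc_of_extends (by simpa using ⟨hKS, hKc⟩) (fun u x hu hlim => ?_) ?_
    · refine sublevel_of_tendsto hQ hR hSig hX hu ?_
      have hc : Continuous fun t : ℝ => K - t • G := by fun_prop
      exact (hc.tendsto x).comp hlim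
    · intro x hx hseg
      obtain ⟨g, hg, hev⟩ := exists_slope_cost hQ hR hSig hX hY
        (hseg x ⟨hx.1, le_rfl⟩).1 (-G)
      have hshift : Tendsto (fun y : ℝ => y - x) (𝓝[>] x) (𝓝 0) := by
        have hc : Continuous fun y : ℝ => y - x := by fun_prop
        simpa using (hc.tendsto x).mono_left nhdsWithin_le_nhds
      have e : ∀ y : ℝ, K - x • G + (y - x) • -G = K - y • G := fun y => by
        rw [smul_neg, sub_smul]
        abel
      rcases hx.1.eq_or_lt with h0 | h0
      · subst h0
        rw [zero_smul, sub_zero] at hg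
        rw [← neg_one_smul ℝ G, frobInner_smul_right, hG] at hg
        have hneg := hg.eventually_lt_const (show -1 * frobInner G G < 0 by linarith)
        filter_upwards [hshift.eventually hev, hshift.eventually hneg, self_mem_nhdsWithin]
          with y hy hgy hy0
        rw [e] at hy
        refine ⟨hy.1, ?_⟩
        rw [hy.2, zero_smul, sub_zero, sub_zero]
        rw [sub_zero] at hgy
        have := mul_neg_of_pos_of_neg (mem_Ioi.1 hy0) hgy
        linarith
      · have hlt : trace (X (K - x • G) * Sig) < c := by
          refine (hdesc x hx.1 hseg).trans_lt ?_
          have hLx : L * x ≤ 1 := by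
            have := mul_le_mul_of_nonneg_left hx.2 hL.le
            rwa [mul_one_div_cancel hL.ne'] at this
          have : 0 < x * (1 - L * x / 2) * frobInner G G :=
            mul_pos (mul_pos h0 (by linarith)) hpos
          linarith
        have hlim : Tendsto (fun t : ℝ => trace (X (K - x • G) * Sig) + t * g t) (𝓝 0)
            (𝓝 (trace (X (K - x • G) * Sig))) := by
          simpa using tendsto_const_nhds.add (tendsto_id.mul hg)
        filter_upwards [hshift.eventually hev, hshift.eventually (hlim.eventually_lt_const hlt)]
          with y hy hyc
        rw [e] at hy
        exact ⟨hy.1, hy.2.trans_le hyc.le⟩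
  have hend := hall (1 / L) ⟨hLinv.le, le_rfl⟩
  refine ⟨hmem _, hend.1, hend.2, (hdesc (1 / L) hLinv.le hall).trans_eq ?_⟩
  field_simp
  ring

/-- If a nonnegative sequence decreases by at least `r j / M` at each step, the smallest of
`r 0, …, r N` is at most `M f₀ / (N + 1)`. -/
theorem exists_le_of_sufficient_decrease {f r : ℕ → ℝ} {M : ℝ} (hM : 0 < M) (hf : ∀ j, 0 ≤ f j)
    (hdec : ∀ j, f (j + 1) ≤ f j - r j / M) (N : ℕ) :
    ∃ j ≤ N, r j ≤ M * f 0 / (N + 1) := by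
  have hsum : ∀ N : ℕ, ∑ j ∈ Finset.range N, r j ≤ M * (f 0 - f N) := by
    intro N
    induction N with
    | zero => simp
    | succ N ih =>
      rw [Finset.sum_range_succ]
      have := mul_le_mul_of_nonneg_left (hdec N) hM.le
      rw [mul_sub, mul_div_cancel₀ _ hM.ne'] at this
      linarith
  by_contra! h
  have hlt : ∑ _j ∈ Finset.range (N + 1), M * f 0 / (N + 1) < ∑ j ∈ Finset.range (N + 1), r j :=
    Finset.sum_lt_sum_of_nonempty ⟨0, by simp⟩ fun j hj =>
      h j (Nat.lt_succ_iff.1 (Finset.mem_range.1 hj))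
  rw [Finset.sum_const, Finset.card_range, nsmul_eq_mul, Nat.cast_succ,
    mul_div_cancel₀ _ (by positivity)] at hlt
  have := hsum (N + 1)
  have := mul_nonneg hM.le (hf (N + 1))
  linarith

end Descent

theorem stmt19 {n m : ℕ} (hn : 0 < n) (hm : 0 < m)
    (A : Matrix (Fin n) (Fin n) ℝ) (B : Matrix (Fin n) (Fin m) ℝ)
    (Q Sig : Matrix (Fin n) (Fin n) ℝ) (R : Matrix (Fin m) (Fin m) ℝ)
    (hQ : Q.PosDef) (hR : R.PosDef) (hSig : Sig.PosDef)
    (X : Matrix (Fin m) (Fin n) ℝ → Matrix (Fin n) (Fin n) ℝ)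
    (Y : Matrix (Fin m) (Fin n) ℝ → Matrix (Fin n) (Fin n) ℝ)
    (hX : ∀ K, IsSchur (A - B * K) →
      (A - B * K)ᵀ * X K * (A - B * K) + Kᵀ * R * K + Q = X K)
    (hY : ∀ K, IsSchur (A - B * K) →
      (A - B * K) * Y K * (A - B * K)ᵀ + Sig = Y K)
    -- `U` is a linear subspace and `P` the orthogonal projection onto `U`
    -- with respect to the Frobenius inner product
    (U : Submodule ℝ (Matrix (Fin m) (Fin n) ℝ))
    (P : Matrix (Fin m) (Fin n) ℝ → Matrix (Fin m) (Fin n) ℝ)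
    (hPmem : ∀ K, P K ∈ U)
    (hPid : ∀ K ∈ U, P K = K)
    (hPorth : ∀ K, ∀ W ∈ U, frobInner (K - P K) W = 0)
    -- the initial gain is structured and stabilizing
    (K₀ : Matrix (Fin m) (Fin n) ℝ) (hK₀U : K₀ ∈ U) (hK₀S : IsSchur (A - B * K₀))
    -- `L` is a quadratic-upper-bound (Lipschitz-gradient) constant for `f`
    -- along segments in `U` contained in the sublevel set `S_{f(K₀)}`
    (L : ℝ) (hL : 0 < L)
    (hquad : ∀ K, (IsSchur (A - B * K) ∧
        Matrix.trace (X K * Sig) ≤ Matrix.trace (X K₀ * Sig) ∧ K ∈ U) →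
      ∀ K' ∈ U,
        (∀ t ∈ Set.Icc (0 : ℝ) 1, IsSchur (A - B * (K + t • (K' - K))) ∧
          Matrix.trace (X (K + t • (K' - K)) * Sig) ≤ Matrix.trace (X K₀ * Sig)) →
        Matrix.trace (X K' * Sig)
          ≤ Matrix.trace (X K * Sig) + frobInner (gradLQR A B R X Y K) (K' - K)
            + L / 2 * frobInner (K' - K) (K' - K))
    -- the projected gradient descent iterates
    (Kseq : ℕ → Matrix (Fin m) (Fin n) ℝ) (hK0 : Kseq 0 = K₀)
    (hrec : ∀ j, Kseq (j + 1) = Kseq j - (1 / L) • P (gradLQR A B R X Y (Kseq j))) :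
    (∀ j, Kseq j ∈ U ∧ IsSchur (A - B * Kseq j) ∧
      Matrix.trace (X (Kseq j) * Sig) ≤ Matrix.trace (X K₀ * Sig)) ∧
    (∀ j, Matrix.trace (X (Kseq (j + 1)) * Sig) ≤ Matrix.trace (X (Kseq j) * Sig)) ∧
    ∀ N : ℕ, ∃ j ≤ N,
      frobInner (P (gradLQR A B R X Y (Kseq j))) (P (gradLQR A B R X Y (Kseq j)))
        ≤ 2 * L * Matrix.trace (X K₀ * Sig) / (N + 1) := by
  have : NeZero n := ⟨hn.ne'⟩
  have hG : ∀ K, frobInner (gradLQR A B R X Y K) (P (gradLQR A B R X Y K))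
      = frobInner (P (gradLQR A B R X Y K)) (P (gradLQR A B R X Y K)) := fun K => by
    have := hPorth (gradLQR A B R X Y K) _ (hPmem (gradLQR A B R X Y K))
    rwa [frobInner_sub_left, sub_eq_zero] at this
  have hstep : ∀ j, (Kseq j ∈ U ∧ IsSchur (A - B * Kseq j) ∧
      Matrix.trace (X (Kseq j) * Sig) ≤ Matrix.trace (X K₀ * Sig)) →
      _ := fun j hj =>
    projected_gradient_step hQ hR hSig hX hY hL hj.1 hj.2.1 hj.2.2 (hPmem _) (hG (Kseq j))
      (hquad _ ⟨hj.2.1, hj.2.2, hj.1⟩)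
  simp only [← hrec] at hstep
  have hfeas : ∀ j, Kseq j ∈ U ∧ IsSchur (A - B * Kseq j) ∧
      Matrix.trace (X (Kseq j) * Sig) ≤ Matrix.trace (X K₀ * Sig) := by
    intro j
    induction j with
    | zero => rw [hK0]; exact ⟨hK₀U, hK₀S, le_rfl⟩
    | succ j ih =>
      obtain ⟨h1, h2, h3, -⟩ := hstep j ih
      exact ⟨h1, h2, h3⟩
  have hdec := fun j => (hstep j (hfeas j)).2.2.2
  refine ⟨hfeas, fun j => (hdec j).trans (sub_le_self _ ?_), ?_⟩
  · exact div_nonneg (frobInner_self_nonneg _) (by positivity)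
  · have hnonneg : ∀ j, 0 ≤ Matrix.trace (X (Kseq j) * Sig) := fun j =>
      (valueMatrix_posSemidef hQ hR hX (hfeas j).2.1).trace_mul_nonneg_s19 hSig.posSemidef
    simpa only [hK0] using exists_le_of_sufficient_decrease (by positivity) hnonneg hdec
end
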